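/- arXiv:1504.05013 — 4 statements merged into one kernel-verified Lean document; each statement's English description precedes it below -/
import Mathlib

section
/- The ring H_res = ℂ[x1,x2,x3]/⟨x1²−x1x3, x2²−x2x3, x3²⟩ is an 8-dimensional ℂ-vector space, and the eight elements 1, x1, x2, x3, x1x2−x1x3−x2x3, x1x3, x2x3, x1x2x3 form a ℂ-basis of H_res. -/
noncomputable section
open MvPolynomial

/-- The polynomial ring ℂ[x1,x2,x3]. -/
abbrev Poly3 := MvPolynomial (Fin 3) ℂ

/-- The ideal ⟨x1²−x1x3, x2²−x2x3, x3²⟩. -/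
def Ires : Ideal Poly3 :=
  Ideal.span {X 0 ^ 2 - X 0 * X 2, X 1 ^ 2 - X 1 * X 2, X 2 ^ 2}

/-- H_res = ℂ[x1,x2,x3]/⟨x1²−x1x3, x2²−x2x3, x3²⟩. -/
abbrev Hres := Poly3 ⧸ Ires

def x1 : Hres := Ideal.Quotient.mk Ires (X 0)
def x2 : Hres := Ideal.Quotient.mk Ires (X 1)
def x3 : Hres := Ideal.Quotient.mk Ires (X 2)

/-- The eight elements 1, x1, x2, x3, x1x2−x1x3−x2x3, x1x3, x2x3, x1x2x3. -/
def basRes : Fin 8 → Hres :=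
  ![1, x1, x2, x3, x1 * x2 - x1 * x3 - x2 * x3, x1 * x3, x2 * x3, x1 * x2 * x3]

theorem x1_mul_x1 : x1 * x1 = x1 * x3 := by
  rw [← sub_eq_zero]
  have h : (X 0 ^ 2 - X 0 * X 2 : Poly3) ∈ Ires := Ideal.subset_span (by simp)
  simpa [x1, x3, pow_two] using Ideal.Quotient.eq_zero_iff_mem.mpr h

theorem x2_mul_x2 : x2 * x2 = x2 * x3 := by
  rw [← sub_eq_zero]
  have h : (X 1 ^ 2 - X 1 * X 2 : Poly3) ∈ Ires := Ideal.subset_span (by simp)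
  simpa [x2, x3, pow_two] using Ideal.Quotient.eq_zero_iff_mem.mpr h

theorem x3_mul_x3 : x3 * x3 = 0 := by
  have h : (X 2 ^ 2 : Poly3) ∈ Ires := Ideal.subset_span (by simp)
  simpa [x3, pow_two] using Ideal.Quotient.eq_zero_iff_mem.mpr h

/-- The span of `basRes` is stable under multiplication by the generators. -/
theorem mul_basRes_mem_span (i : Fin 3) (j : Fin 8) :
    basRes j * Ideal.Quotient.mk Ires (X i) ∈ Submodule.span ℂ (Set.range basRes) := by
  have hb (k : Fin 8) : basRes k ∈ Submodule.span ℂ (Set.range basRes) :=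
    Submodule.subset_span ⟨k, rfl⟩
  have h1 : x1 ∈ Submodule.span ℂ (Set.range basRes) := hb 1
  have h2 : x2 ∈ Submodule.span ℂ (Set.range basRes) := hb 2
  have h3 : x3 ∈ Submodule.span ℂ (Set.range basRes) := hb 3
  have h13 : x1 * x3 ∈ Submodule.span ℂ (Set.range basRes) := hb 5
  have h23 : x2 * x3 ∈ Submodule.span ℂ (Set.range basRes) := hb 6
  have h123 : x1 * x2 * x3 ∈ Submodule.span ℂ (Set.range basRes) := hb 7
  have h12 : x1 * x2 ∈ Submodule.span ℂ (Set.range basRes) := by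
    have h := add_mem (add_mem (hb 4) h13) h23
    have e : basRes 4 + x1 * x3 + x2 * x3 = x1 * x2 := by
      change x1 * x2 - x1 * x3 - x2 * x3 + x1 * x3 + x2 * x3 = x1 * x2
      ring
    rwa [e] at h
  have h0 := zero_mem (Submodule.span ℂ (Set.range basRes))
  have hn := neg_mem h123
  have e1 := x1_mul_x1
  have e2 := x2_mul_x2
  have e3 := x3_mul_x3
  generalize Submodule.span ℂ (Set.range basRes) = W at *
  fin_cases i
  · change basRes j * x1 ∈ W
    fin_cases j <;> simp only [basRes] <;> clear hb
    · simpa using h1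
    · exact e1 ▸ h13
    · exact mul_comm x1 x2 ▸ h12
    · exact mul_comm x1 x3 ▸ h13
    · convert h0 using 1
      change (x1 * x2 - x1 * x3 - x2 * x3) * x1 = 0
      linear_combination (x2 - x3) * e1 - x1 * e3
    · convert h0 using 1
      change x1 * x3 * x1 = 0
      linear_combination x3 * e1 + x1 * e3
    · convert h123 using 1
      change x2 * x3 * x1 = _
      ring
    · convert h0 using 1
      change x1 * x2 * x3 * x1 = 0
      linear_combination x2 * x3 * e1 + x1 * x2 * e3
  · change basRes j * x2 ∈ W
    fin_cases j <;> simp only [basRes] <;> clear hb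
    · simpa using h2
    · exact h12
    · exact e2 ▸ h23
    · exact mul_comm x2 x3 ▸ h23
    · convert h0 using 1
      change (x1 * x2 - x1 * x3 - x2 * x3) * x2 = 0
      linear_combination (x1 - x3) * e2 - x2 * e3
    · convert h123 using 1
      change x1 * x3 * x2 = _
      ring
    · convert h0 using 1
      change x2 * x3 * x2 = 0
      linear_combination x3 * e2 + x2 * e3
    · convert h0 using 1
      change x1 * x2 * x3 * x2 = 0
      linear_combination x1 * x3 * e2 + x1 * x2 * e3
  · change basRes j * x3 ∈ W
    fin_cases j <;> simp only [basRes] <;> clear hb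
    · simpa using h3
    · exact h13
    · exact h23
    · exact e3 ▸ h0
    · convert h123 using 1
      change (x1 * x2 - x1 * x3 - x2 * x3) * x3 = _
      linear_combination (- x1 - x2) * e3
    · convert h0 using 1
      change x1 * x3 * x3 = 0
      linear_combination x1 * e3
    · convert h0 using 1
      change x2 * x3 * x3 = 0
      linear_combination x2 * e3
    · convert h0 using 1
      change x1 * x2 * x3 * x3 = 0
      linear_combination x1 * x2 * e3

theorem span_range_basRes : Submodule.span ℂ (Set.range basRes) = ⊤ := by
  rw [eq_top_iff]
  rintro y -
  obtain ⟨p, rfl⟩ := Ideal.Quotient.mk_surjective y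
  induction p using MvPolynomial.induction_on with
  | C a =>
    have h : basRes 0 ∈ Submodule.span ℂ (Set.range basRes) := Submodule.subset_span ⟨0, rfl⟩
    have h' := Submodule.smul_mem _ a h
    convert h' using 1
    change _ = a • (1 : Hres)
    rw [← Algebra.algebraMap_eq_smul_one]
    rfl
  | add p q hp hq => simpa using add_mem hp hq
  | mul_X p i hp =>
    rw [map_mul]
    generalize Ideal.Quotient.mk Ires p = y at hp ⊢
    induction hp using Submodule.span_induction with
    | mem z hz =>
      obtain ⟨j, rfl⟩ := hz
      exact mul_basRes_mem_span i j
    | zero => simp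
    | add z w _ _ hz hw => simpa [add_mul] using add_mem hz hw
    | smul c z _ hz => exact (smul_mul_assoc c z (Ideal.Quotient.mk Ires (X i))).symm ▸ Submodule.smul_mem _ c hz

/-- `ℂ[ε]` with `ε ^ 2 = 0`. -/
abbrev TowerBase := QuadraticAlgebra ℂ 0 0

/-- `ℂ[ε][u]` with `u ^ 2 = u * ε`. -/
abbrev TowerMid := QuadraticAlgebra TowerBase 0 ⟨0, 1⟩

/-- `ℂ[ε][u][v]` with `v ^ 2 = v * ε`, an explicit eight-dimensional model of `Hres`. -/
abbrev TowerTop := QuadraticAlgebra TowerMid 0 ⟨⟨0, 1⟩, 0⟩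

/-- The images `u, v, ε` of the generators in the model. -/
def towerGen : Fin 3 → TowerTop := ![⟨⟨0, 1⟩, 0⟩, ⟨0, 1⟩, ⟨⟨⟨0, 1⟩, 0⟩, 0⟩]

theorem Ires_le_ker : Ires ≤ RingHom.ker (aeval towerGen : Poly3 →ₐ[ℂ] TowerTop) := by
  rw [Ires, Ideal.span_le]
  rintro p (rfl | rfl | rfl) <;>
    simp [towerGen, RingHom.mem_ker, pow_two, QuadraticAlgebra.ext_iff]

/-- The comparison map from `Hres` to the model. -/
def toTower : Hres →ₐ[ℂ] TowerTop :=
  Ideal.Quotient.liftₐ Ires (aeval towerGen) fun _ h => Ires_le_ker h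

theorem toTower_mk_X (i : Fin 3) : toTower (Ideal.Quotient.mk Ires (X i)) = towerGen i := by
  change aeval towerGen (X i) = _
  simp

theorem linearIndependent_basRes : LinearIndependent ℂ basRes := by
  apply LinearIndependent.of_comp toTower.toLinearMap
  rw [Fintype.linearIndependent_iff]
  intro g hg
  have t1 : toTower x1 = ⟨⟨0, 1⟩, 0⟩ := toTower_mk_X 0
  have t2 : toTower x2 = ⟨0, 1⟩ := toTower_mk_X 1
  have t3 : toTower x3 = ⟨⟨⟨0, 1⟩, 0⟩, 0⟩ := toTower_mk_X 2
  simp [Fin.sum_univ_eight, basRes, t1, t2, t3, QuadraticAlgebra.ext_iff, QuadraticAlgebra.re_one,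
    QuadraticAlgebra.im_one] at hg
  intro i
  fin_cases i <;> grind

theorem stmt1 :
    Module.finrank ℂ Hres = 8 ∧
    LinearIndependent ℂ basRes ∧
    Submodule.span ℂ (Set.range basRes) = ⊤ := by
  refine ⟨?_, linearIndependent_basRes, span_range_basRes⟩
  simpa using Module.finrank_eq_card_basis
    (Module.Basis.mk linearIndependent_basRes span_range_basRes.ge)
end
end

section
/- The three operators B1, B2, B3 (small quantum multiplication by the divisor classes x1, x2, x3 on the toric resolution X_res of the degenerate flag threefold) pairwise commute: B1B2 = B2B1, B1B3 = B3B1 and B2B3 = B3B2, as linear operators on the free module of rank 8 over ℂ[q1,q2,q3][(1−q3)⁻¹]. -/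
noncomputable section
open MvPolynomial

/-- The element 1 − q3. -/
def f : Poly3 := 1 - X 2

/-- The ring ℂ[q1,q2,q3][(1−q3)⁻¹]. -/
abbrev RL := Localization.Away f

/-- The images q1, q2, q3 of the variables in the localization. -/
def q (i : Fin 3) : RL := algebraMap Poly3 RL (X i)

/-- The inverse of 1 − q3 in the localization. -/
def u : RL := IsLocalization.Away.invSelf f

/-- B1, quantum multiplication by x1 on H_res, in the basis e1,…,e8
(the (i,j) entry is the e_i-coefficient of B1(e_j)). -/
def B1 : Matrix (Fin 8) (Fin 8) RL :=
  !![0, q 0, 0, 0, 0, 0, 0, q 0 * q 1 * q 2;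
     1, 0, 0, 0, 0, 0, 0, 0;
     0, 0, 0, 0, q 0 * (1 - q 2), q 0 * q 2, 0, 0;
     0, 0, 0, 0, -(q 0 * (1 - q 2)), q 0 * (1 - q 2), 0, 0;
     0, 0, 1, 0, 0, 0, 0, 0;
     0, 1, 1, 1, 0, 0, 0, 0;
     0, 0, 1, 0, 0, 0, 0, q 0;
     0, 0, 0, 0, 0, 0, 1, 0]

/-- B2, quantum multiplication by x2 on H_res. -/
def B2 : Matrix (Fin 8) (Fin 8) RL :=
  !![0, 0, q 1, 0, 0, 0, 0, q 0 * q 1 * q 2;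
     0, 0, 0, 0, q 1 * (1 - q 2), 0, q 1 * q 2, 0;
     1, 0, 0, 0, 0, 0, 0, 0;
     0, 0, 0, 0, -(q 1 * (1 - q 2)), 0, q 1 * (1 - q 2), 0;
     0, 1, 0, 0, 0, 0, 0, 0;
     0, 1, 0, 0, 0, 0, 0, q 1;
     0, 1, 1, 1, 0, 0, 0, 0;
     0, 0, 0, 0, 0, 1, 0, 0]

/-- B3, quantum multiplication by x3 on H_res; the (5,4) entry is q3/(1−q3). -/
def B3 : Matrix (Fin 8) (Fin 8) RL :=
  !![0, 0, 0, 0, 0, 0, 0, q 0 * q 1 * q 2;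
     0, 0, 0, 0, -(q 1 * q 2), 0, q 1 * q 2, 0;
     0, 0, 0, 0, -(q 0 * q 2), q 0 * q 2, 0, 0;
     1, 0, 0, 0, q 2 * (q 0 + q 1), -(q 0 * q 2), -(q 1 * q 2), 0;
     0, 0, 0, q 2 * u, 0, 0, 0, 0;
     0, 1, 0, 0, 0, 0, 0, 0;
     0, 0, 1, 0, 0, 0, 0, 0;
     0, 0, 0, 0, 1, 0, 0, 0]

/-- The matrix `B1` with the parameters in an arbitrary commutative ring. -/
def B1Generic {R : Type*} [CommRing R] (a b c : R) : Matrix (Fin 8) (Fin 8) R :=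
  !![0, a, 0, 0, 0, 0, 0, a * b * c;
     1, 0, 0, 0, 0, 0, 0, 0;
     0, 0, 0, 0, a * (1 - c), a * c, 0, 0;
     0, 0, 0, 0, -(a * (1 - c)), a * (1 - c), 0, 0;
     0, 0, 1, 0, 0, 0, 0, 0;
     0, 1, 1, 1, 0, 0, 0, 0;
     0, 0, 1, 0, 0, 0, 0, a;
     0, 0, 0, 0, 0, 0, 1, 0]

/-- The matrix `B2` with the parameters in an arbitrary commutative ring. -/
def B2Generic {R : Type*} [CommRing R] (a b c : R) : Matrix (Fin 8) (Fin 8) R :=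
  !![0, 0, b, 0, 0, 0, 0, a * b * c;
     0, 0, 0, 0, b * (1 - c), 0, b * c, 0;
     1, 0, 0, 0, 0, 0, 0, 0;
     0, 0, 0, 0, -(b * (1 - c)), 0, b * (1 - c), 0;
     0, 1, 0, 0, 0, 0, 0, 0;
     0, 1, 0, 0, 0, 0, 0, b;
     0, 1, 1, 1, 0, 0, 0, 0;
     0, 0, 0, 0, 0, 1, 0, 0]

/-- The matrix `B3` with the parameters in an arbitrary commutative ring. -/
def B3Generic {R : Type*} [CommRing R] (a b c v : R) : Matrix (Fin 8) (Fin 8) R :=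
  !![0, 0, 0, 0, 0, 0, 0, a * b * c;
     0, 0, 0, 0, -(b * c), 0, b * c, 0;
     0, 0, 0, 0, -(a * c), a * c, 0, 0;
     1, 0, 0, 0, c * (a + b), -(a * c), -(b * c), 0;
     0, 0, 0, c * v, 0, 0, 0, 0;
     0, 1, 0, 0, 0, 0, 0, 0;
     0, 0, 1, 0, 0, 0, 0, 0;
     0, 0, 0, 0, 1, 0, 0, 0]

set_option maxHeartbeats 2000000 in
theorem B1Generic_mul_B2Generic {R : Type*} [CommRing R] (a b c : R) :
    B1Generic a b c * B2Generic a b c = B2Generic a b c * B1Generic a b c := by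
  ext i j
  fin_cases i <;> fin_cases j <;>
    simp [B1Generic, B2Generic, Matrix.mul_apply, Fin.sum_univ_succ] <;> grind

set_option maxHeartbeats 2000000 in
theorem B1Generic_mul_B3Generic {R : Type*} [CommRing R] (a b c v : R) (h : (1 - c) * v = 1) :
    B1Generic a b c * B3Generic a b c v = B3Generic a b c v * B1Generic a b c := by
  ext i j
  fin_cases i <;> fin_cases j <;>
    simp [B1Generic, B3Generic, Matrix.mul_apply, Fin.sum_univ_succ] <;> grind

set_option maxHeartbeats 2000000 in
theorem B2Generic_mul_B3Generic {R : Type*} [CommRing R] (a b c v : R) (h : (1 - c) * v = 1) :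
    B2Generic a b c * B3Generic a b c v = B3Generic a b c v * B2Generic a b c := by
  ext i j
  fin_cases i <;> fin_cases j <;>
    simp [B2Generic, B3Generic, Matrix.mul_apply, Fin.sum_univ_succ] <;> grind

theorem one_sub_q_two_mul_u : (1 - q 2) * u = 1 := by
  have h : algebraMap Poly3 RL (1 - X 2) * u = 1 :=
    IsLocalization.Away.mul_invSelf (S := RL) f
  rwa [map_sub, map_one] at h

theorem stmt2 : B1 * B2 = B2 * B1 ∧ B1 * B3 = B3 * B1 ∧ B2 * B3 = B3 * B2 :=
  ⟨B1Generic_mul_B2Generic (q 0) (q 1) (q 2),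
    B1Generic_mul_B3Generic (q 0) (q 1) (q 2) u one_sub_q_two_mul_u,
    B2Generic_mul_B3Generic (q 0) (q 1) (q 2) u one_sub_q_two_mul_u⟩
end
end

section
/- In the ring R = ℂ[m1,m2,m3]/⟨m2², m3², m1²(m1−m2)(m1−m2−m3)(m1−m3)⟩, the 20 monomials 1, m1, m2, m3, m1², m1m2, m1m3, m2m3, m1³, m1²m2, m1²m3, m1m2m3, m1⁴, m1³m2, m1³m3, m1²m2m3, m1⁵, m1⁴m2, m1⁴m3, m1⁶ form a ℂ-vector-space basis (so R has ℂ-dimension 20), and the relations m1⁵ = 2m1⁴m2 + 2m1⁴m3 − 3m1³m2m3, m1⁵m2 = m1⁵m3 = 2m1⁴m2m3, m1⁶ = 5m1⁴m2m3 and m1⁷ = 0 hold in R. -/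
noncomputable section
open MvPolynomial

/-- The ideal ⟨m2², m3², m1²(m1−m2)(m1−m2−m3)(m1−m3)⟩. -/
def IR : Ideal Poly3 :=
  Ideal.span {X 1 ^ 2, X 2 ^ 2,
    X 0 ^ 2 * (X 0 - X 1) * (X 0 - X 1 - X 2) * (X 0 - X 2)}

/-- R = ℂ[m1,m2,m3]/⟨m2², m3², m1²(m1−m2)(m1−m2−m3)(m1−m3)⟩, the cohomology
ring of the toric resolution of the toric degeneration of Gr(2,5). -/
abbrev R := Poly3 ⧸ IR

def m1 : R := Ideal.Quotient.mk IR (X 0)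
def m2 : R := Ideal.Quotient.mk IR (X 1)
def m3 : R := Ideal.Quotient.mk IR (X 2)

/-- The 20 monomials. -/
def mon : Fin 20 → R :=
  ![1, m1, m2, m3, m1 ^ 2, m1 * m2, m1 * m3, m2 * m3,
    m1 ^ 3, m1 ^ 2 * m2, m1 ^ 2 * m3, m1 * m2 * m3,
    m1 ^ 4, m1 ^ 3 * m2, m1 ^ 3 * m3, m1 ^ 2 * (m2 * m3),
    m1 ^ 5, m1 ^ 4 * m2, m1 ^ 4 * m3, m1 ^ 6]

section AdjoinRootMonic

variable {A : Type*} [CommRing A]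

theorem AdjoinRoot.free_of_monic {f : Polynomial A} (hf : f.Monic) :
    Module.Free A (AdjoinRoot f) :=
  Module.Free.of_basis (AdjoinRoot.powerBasis' hf).basis

theorem AdjoinRoot.finrank_of_monic [Nontrivial A] {f : Polynomial A} (hf : f.Monic) :
    Module.finrank A (AdjoinRoot f) = f.natDegree := by
  rw [(AdjoinRoot.powerBasis' hf).finrank, AdjoinRoot.powerBasis'_dim]

theorem AdjoinRoot.nontrivial_of_monic [Nontrivial A] {f : Polynomial A} (hf : f.Monic)
    (hd : 0 < f.natDegree) : Nontrivial (AdjoinRoot f) :=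
  Module.nontrivial_of_finrank_pos (R := A) (by rwa [AdjoinRoot.finrank_of_monic hf])

theorem AdjoinRoot.mem_subring {f : Polynomial A} (S : Subring (AdjoinRoot f))
    (hroot : AdjoinRoot.root f ∈ S) (hof : ∀ a, AdjoinRoot.of f a ∈ S) (x : AdjoinRoot f) :
    x ∈ S := by
  induction x using AdjoinRoot.induction_on with
  | ih p =>
    induction p using Polynomial.induction_on' with
    | add p q hp hq => rw [map_add]; exact S.add_mem hp hq
    | monomial n a =>
      rw [← Polynomial.C_mul_X_pow_eq_monomial, map_mul, map_pow, AdjoinRoot.mk_X,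
        AdjoinRoot.mk_C]
      exact S.mul_mem (hof a) (S.pow_mem hroot n)

end AdjoinRootMonic

/-- The model `ℂ[a]/(a²)`. -/
abbrev ModelA := AdjoinRoot (Polynomial.X ^ 2 : Polynomial ℂ)

/-- The model `ℂ[a, b]/(a², b²)`. -/
abbrev ModelAB := AdjoinRoot (Polynomial.X ^ 2 : Polynomial ModelA)

/-- The class of `a` in `ℂ[a, b]/(a², b²)`. -/
def modelA : ModelAB := AdjoinRoot.of _ (AdjoinRoot.root _)

/-- The class of `b` in `ℂ[a, b]/(a², b²)`. -/
def modelB : ModelAB := AdjoinRoot.root _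

/-- The monic quintic satisfied by `m1` over `ℂ[a, b]/(a², b²)`. -/
def quintic : Polynomial ModelAB :=
  Polynomial.X ^ 2 * (Polynomial.X - Polynomial.C modelA) *
    (Polynomial.X - Polynomial.C (modelA + modelB)) * (Polynomial.X - Polynomial.C modelB)

/-- The ring `R` presented as a tower of simple extensions. -/
abbrev Model := AdjoinRoot quintic

theorem quintic_monic : quintic.Monic :=
  (((Polynomial.monic_X_pow 2).mul (Polynomial.monic_X_sub_C _)).mul
    (Polynomial.monic_X_sub_C _)).mul (Polynomial.monic_X_sub_C _)

instance : Nontrivial ModelA :=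
  AdjoinRoot.nontrivial_of_monic (Polynomial.monic_X_pow 2) (by simp)

instance : Nontrivial ModelAB :=
  AdjoinRoot.nontrivial_of_monic (Polynomial.monic_X_pow 2) (by simp)

theorem quintic_natDegree : quintic.natDegree = 5 := by
  have h2 := Polynomial.monic_X_pow (R := ModelAB) 2
  have h3 := h2.mul (Polynomial.monic_X_sub_C modelA)
  have h4 := h3.mul (Polynomial.monic_X_sub_C (modelA + modelB))
  rw [quintic, h4.natDegree_mul (Polynomial.monic_X_sub_C _),
    h3.natDegree_mul (Polynomial.monic_X_sub_C _), h2.natDegree_mul (Polynomial.monic_X_sub_C _)]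
  simp only [Polynomial.natDegree_X_pow, Polynomial.natDegree_X_sub_C]

theorem finrank_model : Module.finrank ℂ Model = 20 := by
  have := AdjoinRoot.free_of_monic (Polynomial.monic_X_pow (R := ModelA) 2)
  have := AdjoinRoot.free_of_monic quintic_monic
  have : Module.Free ℂ ModelAB := Module.Free.trans (R := ℂ) (S := ModelA)
  rw [← Module.finrank_mul_finrank ℂ ModelAB Model, ← Module.finrank_mul_finrank ℂ ModelA ModelAB,
    AdjoinRoot.finrank_of_monic quintic_monic, quintic_natDegree,
    AdjoinRoot.finrank_of_monic (Polynomial.monic_X_pow 2),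
    AdjoinRoot.finrank_of_monic (Polynomial.monic_X_pow 2)]
  simp

/-- The images of `m1`, `m2`, `m3` in the model. -/
def modelGen : Fin 3 → Model :=
  ![AdjoinRoot.root _, AdjoinRoot.of _ modelA, AdjoinRoot.of _ modelB]

theorem modelA_sq : modelA ^ 2 = 0 := by
  have h : (AdjoinRoot.root (Polynomial.X ^ 2 : Polynomial ℂ)) ^ 2 = 0 := by
    rw [← AdjoinRoot.mk_X, ← map_pow, AdjoinRoot.mk_self]
  rw [modelA, ← map_pow, h, map_zero]

theorem modelB_sq : modelB ^ 2 = 0 := by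
  rw [modelB, ← AdjoinRoot.mk_X, ← map_pow, AdjoinRoot.mk_self]

theorem quintic_root :
    modelGen 0 ^ 2 * (modelGen 0 - modelGen 1) * (modelGen 0 - modelGen 1 - modelGen 2) *
      (modelGen 0 - modelGen 2) = 0 := by
  have h : AdjoinRoot.mk quintic (Polynomial.X ^ 2 * (Polynomial.X - Polynomial.C modelA) *
      (Polynomial.X - Polynomial.C (modelA + modelB)) * (Polynomial.X - Polynomial.C modelB)) = 0 :=
    AdjoinRoot.mk_self
  simp only [map_mul, map_sub, map_add, map_pow, AdjoinRoot.mk_X, AdjoinRoot.mk_C] at h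
  simpa [modelGen, sub_sub] using h

/-- The homomorphism from `R` to its model. -/
def toModel : R →ₐ[ℂ] Model :=
  Ideal.Quotient.liftₐ IR (aeval modelGen) fun p hp => by
    have hle : IR ≤ RingHom.ker (aeval modelGen : Poly3 →ₐ[ℂ] Model) := by
      refine Ideal.span_le.2 ?_
      rintro q (rfl | rfl | rfl) <;> rw [SetLike.mem_coe, RingHom.mem_ker]
      · rw [map_pow, aeval_X]
        change AdjoinRoot.of quintic modelA ^ 2 = 0
        rw [← map_pow, modelA_sq, map_zero]
      · rw [map_pow, aeval_X]
        change AdjoinRoot.of quintic modelB ^ 2 = 0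
        rw [← map_pow, modelB_sq, map_zero]
      · simpa using quintic_root
    exact hle hp

theorem toModel_mk_X (i : Fin 3) : toModel (Ideal.Quotient.mk IR (X i)) = modelGen i :=
  aeval_X modelGen i

theorem toModel_surjective : Function.Surjective toModel := by
  intro x
  let S : Subring Model := toModel.toRingHom.range
  have hgen (i : Fin 3) : modelGen i ∈ S := ⟨_, toModel_mk_X i⟩
  refine AdjoinRoot.mem_subring S (hgen 0) (fun y => ?_) x
  refine AdjoinRoot.mem_subring (S.comap (AdjoinRoot.of quintic)) (hgen 2) (fun z => ?_) y
  refine AdjoinRoot.mem_subring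
    ((S.comap (AdjoinRoot.of quintic)).comap (AdjoinRoot.of _)) (hgen 1) (fun c => ?_) z
  exact ⟨algebraMap ℂ R c, toModel.commutes c⟩

theorem m2_sq : m2 ^ 2 = 0 :=
  Ideal.Quotient.eq_zero_iff_mem.2 (Ideal.subset_span (by simp))

theorem m3_sq : m3 ^ 2 = 0 :=
  Ideal.Quotient.eq_zero_iff_mem.2 (Ideal.subset_span (by simp))

theorem quintic_relation : m1 ^ 2 * (m1 - m2) * (m1 - m2 - m3) * (m1 - m3) = 0 :=
  Ideal.Quotient.eq_zero_iff_mem.2 (Ideal.subset_span (by simp))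

theorem m1_pow_five :
    m1 ^ 5 = 2 * (m1 ^ 4 * m2) + 2 * (m1 ^ 4 * m3) - 3 * (m1 ^ 3 * (m2 * m3)) := by
  linear_combination quintic_relation + (m1 ^ 2 * m3 - m1 ^ 3) * m2_sq +
    (m1 ^ 2 * m2 - m1 ^ 3) * m3_sq

theorem m1_pow_five_mul_m2 : m1 ^ 5 * m2 = 2 * (m1 ^ 4 * (m2 * m3)) := by
  linear_combination m2 * m1_pow_five + (2 * m1 ^ 4 - 3 * m1 ^ 3 * m3) * m2_sq

theorem m1_pow_five_mul_m3 : m1 ^ 5 * m3 = 2 * (m1 ^ 4 * (m2 * m3)) := by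
  linear_combination m3 * m1_pow_five + (2 * m1 ^ 4 - 3 * m1 ^ 3 * m2) * m3_sq

theorem m1_pow_six : m1 ^ 6 = 5 * (m1 ^ 4 * (m2 * m3)) := by
  linear_combination m1 * m1_pow_five + 2 * m1_pow_five_mul_m2 + 2 * m1_pow_five_mul_m3

theorem m1_pow_five_mul_m2_mul_m3 : m1 ^ 5 * (m2 * m3) = 0 := by
  linear_combination m3 * m1_pow_five_mul_m2 + 2 * m1 ^ 4 * m2 * m3_sq

theorem m1_pow_seven : m1 ^ 7 = 0 := by
  linear_combination m1 * m1_pow_six + 5 * m1_pow_five_mul_m2_mul_m3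

theorem mon_mem_span (i : Fin 20) : mon i ∈ Submodule.span ℂ (Set.range mon) :=
  Submodule.subset_span ⟨i, rfl⟩

theorem monomial_mem_span (i j k : ℕ) :
    m1 ^ i * m2 ^ j * m3 ^ k ∈ Submodule.span ℂ (Set.range mon) := by
  have hsmul (c : ℂ) (l : Fin 20) := Submodule.smul_mem _ c (mon_mem_span l)
  have h344 : m1 ^ 4 * (m2 * m3) = (1 / 5 : ℂ) • mon 19 := by
    have h : mon 19 = (5 : ℂ) • (m1 ^ 4 * (m2 * m3)) := by
      rw [ofNat_smul_eq_nsmul, nsmul_eq_mul]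
      exact m1_pow_six
    rw [h, smul_smul]; norm_num
  have h333 : m1 ^ 3 * (m2 * m3) =
      (1 / 3 : ℂ) • ((2 : ℂ) • mon 17 + (2 : ℂ) • mon 18 - mon 16) := by
    have h : (2 : ℂ) • mon 17 + (2 : ℂ) • mon 18 - mon 16 = (3 : ℂ) • (m1 ^ 3 * (m2 * m3)) := by
      simp only [ofNat_smul_eq_nsmul, nsmul_eq_mul]
      change ((2 : ℕ) : R) * (m1 ^ 4 * m2) + ((2 : ℕ) : R) * (m1 ^ 4 * m3) - m1 ^ 5 = _
      push_cast
      linear_combination -m1_pow_five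
    rw [h, smul_smul]; norm_num
  have h4 : m1 ^ 4 * (m2 * m3) ∈ Submodule.span ℂ (Set.range mon) := h344 ▸ hsmul _ _
  have h3 : m1 ^ 3 * (m2 * m3) ∈ Submodule.span ℂ (Set.range mon) := by
    rw [h333]
    exact Submodule.smul_mem _ _ (Submodule.sub_mem _
      (Submodule.add_mem _ (hsmul _ _) (hsmul _ _)) (mon_mem_span _))
  have h52 : m1 ^ 5 * m2 ∈ Submodule.span ℂ (Set.range mon) := by
    rw [m1_pow_five_mul_m2, two_mul]; exact Submodule.add_mem _ h4 h4
  have h53 : m1 ^ 5 * m3 ∈ Submodule.span ℂ (Set.range mon) := by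
    rw [m1_pow_five_mul_m3, two_mul]; exact Submodule.add_mem _ h4 h4
  have h62 : m1 ^ 6 * m2 = 0 := by
    linear_combination m1 * m1_pow_five_mul_m2 + 2 * m1_pow_five_mul_m2_mul_m3
  have h63 : m1 ^ 6 * m3 = 0 := by
    linear_combination m1 * m1_pow_five_mul_m3 + 2 * m1_pow_five_mul_m2_mul_m3
  by_cases hi : 7 ≤ i
  · simp [pow_eq_zero_of_le hi m1_pow_seven]
  by_cases hj : 2 ≤ j
  · simp [pow_eq_zero_of_le hj m2_sq]
  by_cases hk : 2 ≤ k
  · simp [pow_eq_zero_of_le hk m3_sq]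
  have hmem (l : Fin 20) {x : R} (h : mon l = x) : x ∈ Submodule.span ℂ (Set.range mon) :=
    h ▸ mon_mem_span l
  push Not at hi hj hk
  interval_cases j <;> interval_cases k <;>
    simp only [pow_zero, pow_one, mul_one, mul_assoc]
  · interval_cases i <;> try simp only [pow_zero, pow_one]
    exacts [hmem 0 rfl, hmem 1 rfl, hmem 4 rfl, hmem 8 rfl, hmem 12 rfl, hmem 16 rfl, hmem 19 rfl]
  · interval_cases i <;> try simp only [pow_zero, pow_one, one_mul]
    exacts [hmem 3 rfl, hmem 6 rfl, hmem 10 rfl, hmem 14 rfl, hmem 18 rfl, h53,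
      h63 ▸ Submodule.zero_mem _]
  · interval_cases i <;> try simp only [pow_zero, pow_one, one_mul]
    exacts [hmem 2 rfl, hmem 5 rfl, hmem 9 rfl, hmem 13 rfl, hmem 17 rfl, h52,
      h62 ▸ Submodule.zero_mem _]
  · interval_cases i <;> try simp only [pow_zero, pow_one, one_mul]
    exacts [hmem 7 rfl, hmem 11 (mul_assoc _ _ _), hmem 15 rfl, h3, h4,
      m1_pow_five_mul_m2_mul_m3 ▸ Submodule.zero_mem _,
      by rw [← mul_assoc, h62, zero_mul]; exact Submodule.zero_mem _]

theorem span_mon : Submodule.span ℂ (Set.range mon) = ⊤ := by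
  refine eq_top_iff.2 fun x _ => ?_
  obtain ⟨p, rfl⟩ := Ideal.Quotient.mk_surjective x
  induction p using MvPolynomial.induction_on' with
  | add p q hp hq => rw [map_add]; exact Submodule.add_mem _ (hp trivial) (hq trivial)
  | monomial s c =>
    have h : Ideal.Quotient.mk IR (monomial s c) = c • (m1 ^ s 0 * m2 ^ s 1 * m3 ^ s 2) := by
      rw [monomial_eq, Finsupp.prod_fintype _ _ (by simp), Fin.prod_univ_three, ← smul_eq_C_mul]
      rfl
    rw [h]
    exact Submodule.smul_mem _ _ (monomial_mem_span _ _ _)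

theorem linearIndependent_mon : LinearIndependent ℂ mon := by
  refine LinearIndependent.of_comp toModel.toLinearMap ?_
  refine linearIndependent_of_top_le_span_of_card_eq_finrank ?_ (by simp [finrank_model])
  rw [Set.range_comp, Submodule.span_image, span_mon, Submodule.map_top,
    LinearMap.range_eq_top.2 toModel_surjective]

theorem stmt10 :
    LinearIndependent ℂ mon ∧
    Submodule.span ℂ (Set.range mon) = ⊤ ∧
    Module.finrank ℂ R = 20 ∧
    m1 ^ 5 = 2 * (m1 ^ 4 * m2) + 2 * (m1 ^ 4 * m3) - 3 * (m1 ^ 3 * (m2 * m3)) ∧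
    m1 ^ 5 * m2 = 2 * (m1 ^ 4 * (m2 * m3)) ∧
    m1 ^ 5 * m3 = 2 * (m1 ^ 4 * (m2 * m3)) ∧
    m1 ^ 6 = 5 * (m1 ^ 4 * (m2 * m3)) ∧
    m1 ^ 7 = 0 := by
  refine ⟨linearIndependent_mon, span_mon, ?_, m1_pow_five, m1_pow_five_mul_m2,
    m1_pow_five_mul_m3, m1_pow_six, m1_pow_seven⟩
  simpa using Module.finrank_eq_card_basis (Module.Basis.mk linearIndependent_mon span_mon.ge)
end
end

section
/- The operators N2 and N3 on R are nilpotent, and with α = m1m2 + m1m3 − m2m3, V = span_ℂ{1, m1, m1², m1³, m1⁴, m1⁵, m1⁶, α, m1α, m1²α, m1⁴m2, m1⁴m3} and W = span_ℂ{m1⁴m2 − m1⁴m3, 2m1⁵ − 5m1⁴m2}, one has Ker N2 ∩ Ker N3 = V (in particular this intersection has dimension 12) and V ∩ (Im N2 + Im N3) = W (in particular this intersection has dimension 2). -/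
noncomputable section
open MvPolynomial

/-- β = (m1−m2)(m1−m2−m3). -/
def β : R := (m1 - m2) * (m1 - m2 - m3)
/-- β' = (m1−m3)(m1−m2−m3). -/
def β' : R := (m1 - m3) * (m1 - m2 - m3)
/-- γ = (m1−m2)(m1−m3)(m1−m2−m3). -/
def γ : R := (m1 - m2) * (m1 - m3) * (m1 - m2 - m3)

/-- The images of the basis monomials under N2 (the residue at q2 = 1 of
quantum multiplication by m2, evaluated at (q2,q3) = (1,1)). -/
def N2img : Fin 20 → R :=
  ![0, 0, -β, 0, 0, -(m1 * β), 0, -(m3 * β) - γ,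
    0, -(m1 ^ 2 * β), 0, -(m1 * m3 * β) - m1 * γ,
    0, -(m1 ^ 3 * β), 0, -(m1 ^ 2 * (m3 * β)),
    0, 0, 0, 0]

/-- The images of the basis monomials under N3 (the residue at q3 = 1 of
quantum multiplication by m3, evaluated at (q2,q3) = (1,1)). -/
def N3img : Fin 20 → R :=
  ![0, 0, 0, -β', 0, 0, -(m1 * β'), -(m2 * β') - γ,
    0, 0, -(m1 ^ 2 * β'), -(m1 * m2 * β') - m1 * γ,
    0, 0, -(m1 ^ 3 * β'), -(m1 ^ 2 * (m2 * β')),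
    0, 0, 0, 0]

/-- α = m1m2 + m1m3 − m2m3. -/
def α : R := m1 * m2 + m1 * m3 - m2 * m3

/-- The 12 spanning elements of V. -/
def Vgen : Fin 12 → R :=
  ![1, m1, m1 ^ 2, m1 ^ 3, m1 ^ 4, m1 ^ 5, m1 ^ 6,
    α, m1 * α, m1 ^ 2 * α, m1 ^ 4 * m2, m1 ^ 4 * m3]

/-- V = span{1, m1, m1², m1³, m1⁴, m1⁵, m1⁶, α, m1α, m1²α, m1⁴m2, m1⁴m3}. -/
def V : Submodule ℂ R := Submodule.span ℂ (Set.range Vgen)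

/-- W = span{m1⁴m2 − m1⁴m3, 2m1⁵ − 5m1⁴m2}. -/
def W : Submodule ℂ R :=
  Submodule.span ℂ {m1 ^ 4 * m2 - m1 ^ 4 * m3, 2 * m1 ^ 5 - 5 * (m1 ^ 4 * m2)}

section Comparison

variable {A : Type*} [CommRing A]

/-- The quintic relation of `R`, as a polynomial in `m1` with `m2 = y` and `m3 = z`. -/
def relPoly (y z : A) : Polynomial A :=
  Polynomial.X ^ 2 * (Polynomial.X - Polynomial.C y) * (Polynomial.X - Polynomial.C (y + z))
    * (Polynomial.X - Polynomial.C z)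

theorem relPoly_monic (y z : A) : (relPoly y z).Monic :=
  (((Polynomial.monic_X_pow 2).mul (Polynomial.monic_X_sub_C y)).mul
    (Polynomial.monic_X_sub_C (y + z))).mul (Polynomial.monic_X_sub_C z)

theorem relPoly_natDegree [Nontrivial A] (y z : A) : (relPoly y z).natDegree = 5 := by
  have h := (Polynomial.monic_X_pow (R := A) 2).mul (Polynomial.monic_X_sub_C y)
  rw [relPoly, (h.mul (Polynomial.monic_X_sub_C (y + z))).natDegree_mul
      (Polynomial.monic_X_sub_C z), h.natDegree_mul (Polynomial.monic_X_sub_C (y + z)),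
    (Polynomial.monic_X_pow 2).natDegree_mul (Polynomial.monic_X_sub_C y)]
  simp only [Polynomial.natDegree_X_pow, Polynomial.natDegree_X_sub_C]

theorem relPoly_root (y z : A) :
    AdjoinRoot.root (relPoly y z) ^ 2 * (AdjoinRoot.root (relPoly y z) - AdjoinRoot.of _ y)
      * (AdjoinRoot.root (relPoly y z) - AdjoinRoot.of _ y - AdjoinRoot.of _ z)
      * (AdjoinRoot.root (relPoly y z) - AdjoinRoot.of _ z) = 0 := by
  have h := AdjoinRoot.mk_self (f := relPoly y z)
  have e : relPoly y z = Polynomial.X ^ 2 * (Polynomial.X - Polynomial.C y)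
    * (Polynomial.X - Polynomial.C y - Polynomial.C z) * (Polynomial.X - Polynomial.C z) := by
    rw [relPoly, Polynomial.C_add, sub_sub]
  calc _ = AdjoinRoot.mk (relPoly y z) (Polynomial.X ^ 2 * (Polynomial.X - Polynomial.C y)
    * (Polynomial.X - Polynomial.C y - Polynomial.C z) * (Polynomial.X - Polynomial.C z)) := by
        simp
    _ = 0 := by rw [← e, h]

theorem eq_zero_of_mk_relPoly_eq_zero [Nontrivial A] {u v a b c d e : A}
    (h : AdjoinRoot.mk (relPoly u v) (Polynomial.C a + Polynomial.C b * Polynomial.X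
      + Polynomial.C c * Polynomial.X ^ 2 + Polynomial.C d * Polynomial.X ^ 3
      + Polynomial.C e * Polynomial.X ^ 4) = 0) :
    a = 0 ∧ b = 0 ∧ c = 0 ∧ d = 0 ∧ e = 0 := by
  have hp := not_imp_not.mp (fun hne => (relPoly_monic u v).not_dvd_of_natDegree_lt hne
    (lt_of_le_of_lt (b := 4) (by compute_degree) (by simp [relPoly_natDegree])))
    (AdjoinRoot.mk_eq_zero.mp h)
  refine ⟨?_, ?_, ?_, ?_, ?_⟩
  · simpa [Polynomial.coeff_X, Polynomial.coeff_C, Polynomial.coeff_X_pow]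
      using congrArg (fun p => p.coeff 0) hp
  · simpa [Polynomial.coeff_X, Polynomial.coeff_C, Polynomial.coeff_X_pow]
      using congrArg (fun p => p.coeff 1) hp
  · simpa [Polynomial.coeff_X, Polynomial.coeff_C, Polynomial.coeff_X_pow]
      using congrArg (fun p => p.coeff 2) hp
  · simpa [Polynomial.coeff_X, Polynomial.coeff_C, Polynomial.coeff_X_pow]
      using congrArg (fun p => p.coeff 3) hp
  · simpa [Polynomial.coeff_X, Polynomial.coeff_C, Polynomial.coeff_X_pow]
      using congrArg (fun p => p.coeff 4) hp

variable [Algebra ℂ A]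

/-- The map from `R` to the quotient of `A[m1]` by the quintic relation that sends `m2` and `m3`
to square-zero elements `y` and `z`. -/
def toAdjoin {y z : A} (hy : y ^ 2 = 0) (hz : z ^ 2 = 0) : R →ₐ[ℂ] AdjoinRoot (relPoly y z) :=
  Ideal.Quotient.liftₐ IR
    (MvPolynomial.aeval ![AdjoinRoot.root (relPoly y z), AdjoinRoot.of (relPoly y z) y,
      AdjoinRoot.of (relPoly y z) z]) (by
    let F : Poly3 →ₐ[ℂ] AdjoinRoot (relPoly y z) := MvPolynomial.aeval
      ![AdjoinRoot.root (relPoly y z), AdjoinRoot.of (relPoly y z) y, AdjoinRoot.of (relPoly y z) z]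
    have h0 : F (X 0) = AdjoinRoot.root (relPoly y z) := MvPolynomial.aeval_X _ _
    have h1 : F (X 1) = AdjoinRoot.of (relPoly y z) y := MvPolynomial.aeval_X _ _
    have h2 : F (X 2) = AdjoinRoot.of (relPoly y z) z := MvPolynomial.aeval_X _ _
    have hle : IR ≤ RingHom.ker F.toRingHom := by
      rw [IR, Ideal.span_le]
      rintro x (rfl | rfl | rfl)
      · change F (X 1 ^ 2) = 0
        rw [map_pow, h1, ← map_pow, hy, map_zero]
      · change F (X 2 ^ 2) = 0
        rw [map_pow, h2, ← map_pow, hz, map_zero]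
      · change F (X 0 ^ 2 * (X 0 - X 1) * (X 0 - X 1 - X 2) * (X 0 - X 2)) = 0
        simp only [map_mul, map_pow, map_sub, h0, h1, h2]
        exact relPoly_root y z
    exact fun a ha => hle ha)

variable {y z : A} (hy : y ^ 2 = 0) (hz : z ^ 2 = 0)

theorem toAdjoin_m1 : toAdjoin hy hz m1 = AdjoinRoot.root (relPoly y z) :=
  MvPolynomial.aeval_X _ _

theorem toAdjoin_m2 : toAdjoin hy hz m2 = AdjoinRoot.of (relPoly y z) y :=
  MvPolynomial.aeval_X _ _

theorem toAdjoin_m3 : toAdjoin hy hz m3 = AdjoinRoot.of (relPoly y z) z :=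
  MvPolynomial.aeval_X _ _

end Comparison

section Abstract

variable {B : Type*} [CommRing B]

/-- The relations satisfied by the generators of `R`. -/
structure Rels (x y z : B) : Prop where
  y_sq : y ^ 2 = 0
  z_sq : z ^ 2 = 0
  quintic : x ^ 2 * (x - y) * (x - y - z) * (x - z) = 0

theorem Rels.x_pow_five {x y z : B} (h : Rels x y z) :
    x ^ 5 = 2 * x ^ 4 * (y + z) - 3 * x ^ 3 * (y * z) := by
  linear_combination h.quintic - (x ^ 3 - x ^ 2 * z) * h.y_sq - (x ^ 3 - x ^ 2 * y) * h.z_sq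

theorem Rels.x_pow_six {x y z : B} (h : Rels x y z) : x ^ 6 = 5 * x ^ 4 * (y * z) := by
  linear_combination (x + 2 * (y + z)) * h.x_pow_five
    + (4 * x ^ 4 - 6 * x ^ 3 * z) * h.y_sq + (4 * x ^ 4 - 6 * x ^ 3 * y) * h.z_sq

theorem Rels.x_six_mul_y {x y z : B} (h : Rels x y z) : x ^ 6 * y = 0 := by
  linear_combination y * h.x_pow_six + 5 * x ^ 4 * z * h.y_sq

theorem Rels.x_six_mul_z {x y z : B} (h : Rels x y z) : x ^ 6 * z = 0 := by
  linear_combination z * h.x_pow_six + 5 * x ^ 4 * y * h.z_sq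

variable [Algebra ℂ B]

/-- The linear combination of the twenty basis monomials in `x`, `y`, `z` with coefficients `c`. -/
def monComb (x y z : B) (c : Fin 20 → ℂ) : B :=
  c 0 • 1 + c 1 • x + c 2 • y + c 3 • z + c 4 • x ^ 2 + c 5 • (x * y) + c 6 • (x * z)
    + c 7 • (y * z) + c 8 • x ^ 3 + c 9 • (x ^ 2 * y) + c 10 • (x ^ 2 * z)
    + c 11 • (x * y * z) + c 12 • x ^ 4 + c 13 • (x ^ 3 * y) + c 14 • (x ^ 3 * z)
    + c 15 • (x ^ 2 * (y * z)) + c 16 • x ^ 5 + c 17 • (x ^ 4 * y) + c 18 • (x ^ 4 * z)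
    + c 19 • x ^ 6

theorem monComb_add (x y z : B) (c d : Fin 20 → ℂ) :
    monComb x y z (c + d) = monComb x y z c + monComb x y z d := by
  simp only [monComb, Pi.add_apply]
  algebra

theorem monComb_smul (x y z : B) (a : ℂ) (c : Fin 20 → ℂ) :
    monComb x y z (a • c) = a • monComb x y z c := by
  simp only [monComb, Pi.smul_apply, smul_eq_mul]
  algebra

theorem Rels.x_cube_mul {x y z : B} (h : Rels x y z) :
    x ^ 3 * (y * z) = (1 / 3 : ℂ) • (2 * x ^ 4 * (y + z) - x ^ 5) := by
  linear_combination (norm := algebra) (1 / 3 : ℂ) • h.x_pow_five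

theorem Rels.x_four_mul {x y z : B} (h : Rels x y z) :
    x ^ 4 * (y * z) = (1 / 5 : ℂ) • x ^ 6 := by
  linear_combination (norm := algebra) (-1 / 5 : ℂ) • h.x_pow_six

theorem Rels.x_five_mul_y {x y z : B} (h : Rels x y z) :
    x ^ 5 * y = (2 / 5 : ℂ) • x ^ 6 := by
  linear_combination (norm := algebra) (-2 / 5 : ℂ) • h.x_pow_six + y * h.x_pow_five
    + (2 * x ^ 4 - 3 * x ^ 3 * z) * h.y_sq

theorem Rels.x_five_mul_z {x y z : B} (h : Rels x y z) :
    x ^ 5 * z = (2 / 5 : ℂ) • x ^ 6 := by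
  linear_combination (norm := algebra) (-2 / 5 : ℂ) • h.x_pow_six + z * h.x_pow_five
    + (2 * x ^ 4 - 3 * x ^ 3 * y) * h.z_sq

theorem Rels.x_pow_seven {x y z : B} (h : Rels x y z) : x ^ 7 = 0 := by
  linear_combination (norm := algebra) x * h.x_pow_six + 5 * z * h.x_five_mul_y
    + 2 * z * h.x_pow_six + 10 * x ^ 4 * y * h.z_sq

theorem Rels.monComb_mul_x {x y z : B} (h : Rels x y z) (c : Fin 20 → ℂ) :
    monComb x y z c * x = monComb x y z ![0, c 0, 0, 0, c 1, c 2, c 3, 0, c 4, c 5, c 6, c 7, c 8,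
      c 9, c 10, c 11, c 12 - 1 / 3 * c 15, c 13 + 2 / 3 * c 15, c 14 + 2 / 3 * c 15,
      c 16 + 2 / 5 * c 17 + 2 / 5 * c 18] := by
  simp only [monComb, Matrix.cons_val]
  linear_combination (norm := algebra) c 15 • h.x_cube_mul + c 17 • h.x_five_mul_y
    + c 18 • h.x_five_mul_z + c 19 • h.x_pow_seven

theorem Rels.monComb_mul_y {x y z : B} (h : Rels x y z) (c : Fin 20 → ℂ) :
    monComb x y z c * y = monComb x y z ![0, 0, c 0, 0, 0, c 1, 0, c 3, 0, c 4, 0, c 6, 0,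
      c 8, 0, c 10, - 1 / 3 * c 14, c 12 + 2 / 3 * c 14, 2 / 3 * c 14,
      2 / 5 * c 16 + 1 / 5 * c 18] := by
  simp only [monComb, Matrix.cons_val]
  linear_combination (norm := algebra) c 14 • h.x_cube_mul + c 16 • h.x_five_mul_y
    + c 18 • h.x_four_mul + c 19 • h.x_six_mul_y
    + (c 2 • 1 + c 5 • x + c 7 • z + c 9 • x ^ 2 + c 11 • (x * z) + c 13 • x ^ 3
      + c 15 • (x ^ 2 * z) + c 17 • x ^ 4) * h.y_sq

theorem Rels.monComb_mul_z {x y z : B} (h : Rels x y z) (c : Fin 20 → ℂ) :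
    monComb x y z c * z = monComb x y z ![0, 0, 0, c 0, 0, 0, c 1, c 2, 0, 0, c 4, c 5, 0,
      0, c 8, c 9, - 1 / 3 * c 13, 2 / 3 * c 13, c 12 + 2 / 3 * c 13,
      2 / 5 * c 16 + 1 / 5 * c 17] := by
  simp only [monComb, Matrix.cons_val]
  linear_combination (norm := algebra) c 13 • h.x_cube_mul + c 16 • h.x_five_mul_z
    + c 17 • h.x_four_mul + c 19 • h.x_six_mul_z
    + (c 3 • 1 + c 6 • x + c 7 • y + c 10 • x ^ 2 + c 11 • (x * y) + c 14 • x ^ 3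
      + c 15 • (x ^ 2 * y) + c 18 • x ^ 4) * h.z_sq

theorem Rels.exists_monComb_eq {x y z : B} (h : Rels x y z)
    (p : MvPolynomial (Fin 3) ℂ) : ∃ c, monComb x y z c = MvPolynomial.aeval ![x, y, z] p := by
  induction p using MvPolynomial.induction_on with
  | C a =>
    refine ⟨![a, 0, 0, 0, 0, 0, 0, 0, 0, 0, 0, 0, 0, 0, 0, 0, 0, 0, 0, 0], ?_⟩
    simp only [monComb, Matrix.cons_val, zero_smul, add_zero, MvPolynomial.aeval_C,
      Algebra.algebraMap_eq_smul_one]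
  | add p q hp hq =>
    obtain ⟨c, hc⟩ := hp
    obtain ⟨d, hd⟩ := hq
    exact ⟨c + d, by rw [monComb_add, hc, hd, map_add]⟩
  | mul_X p i hp =>
    obtain ⟨c, hc⟩ := hp
    rw [map_mul, MvPolynomial.aeval_X, ← hc]
    fin_cases i
    · exact ⟨_, (h.monComb_mul_x c).symm⟩
    · exact ⟨_, (h.monComb_mul_y c).symm⟩
    · exact ⟨_, (h.monComb_mul_z c).symm⟩

theorem Rels.monComb_eq {x y z : B} (h : Rels x y z) (c : Fin 20 → ℂ) :
    monComb x y z c = c 0 • 1 + c 2 • y + c 3 • z + c 7 • (y * z)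
      + (c 1 • 1 + c 5 • y + c 6 • z + c 11 • (y * z)) * x
      + (c 4 • 1 + c 9 • y + c 10 • z + c 15 • (y * z)) * x ^ 2
      + (c 8 • 1 + c 13 • y + c 14 • z + (-3 * c 16) • (y * z)) * x ^ 3
      + (c 12 • 1 + (c 17 + 2 * c 16) • y + (c 18 + 2 * c 16) • z + (5 * c 19) • (y * z))
        * x ^ 4 := by
  simp only [monComb]
  linear_combination (norm := algebra) c 16 • h.x_pow_five + c 19 • h.x_pow_six

theorem Rels.monComb_eq_zero {A : Type*} [CommRing A] [Algebra ℂ A] [Nontrivial A] {u v : A}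
    (huv : ∀ a b c d : ℂ, a • 1 + b • u + c • v + d • (u * v) = 0 →
      a = 0 ∧ b = 0 ∧ c = 0 ∧ d = 0)
    {x y z : B} (h : Rels x y z) (φ : B →ₐ[ℂ] AdjoinRoot (relPoly u v))
    (hx : φ x = AdjoinRoot.root (relPoly u v)) (hy : φ y = AdjoinRoot.of (relPoly u v) u)
    (hz : φ z = AdjoinRoot.of (relPoly u v) v) {c : Fin 20 → ℂ} (hc : monComb x y z c = 0) :
    c = 0 := by
  let q (a b c d : ℂ) : A := a • 1 + b • u + c • v + d • (u * v)
  have hq (a b c d : ℂ) : φ (a • 1 + b • y + c • z + d • (y * z))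
      = AdjoinRoot.mk (relPoly u v) (Polynomial.C (q a b c d)) := by
    simp [q, map_add, map_smul, map_mul, hy, hz, AdjoinRoot.mk_C, ← AdjoinRoot.smul_of]
  have h0 : AdjoinRoot.mk (relPoly u v) (Polynomial.C (q (c 0) (c 2) (c 3) (c 7))
      + Polynomial.C (q (c 1) (c 5) (c 6) (c 11)) * Polynomial.X
      + Polynomial.C (q (c 4) (c 9) (c 10) (c 15)) * Polynomial.X ^ 2
      + Polynomial.C (q (c 8) (c 13) (c 14) (-3 * c 16)) * Polynomial.X ^ 3
      + Polynomial.C (q (c 12) (c 17 + 2 * c 16) (c 18 + 2 * c 16) (5 * c 19))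
        * Polynomial.X ^ 4) = 0 := by
    have := congrArg φ (h.monComb_eq c)
    rw [hc, map_zero] at this
    rw [this, map_add φ, map_add φ, map_add φ, map_add φ, map_mul φ, map_mul φ, map_mul φ,
      map_mul φ, hq, hq, hq, hq, hq, map_pow, map_pow, map_pow, hx]
    simp only [map_add, map_mul, map_pow, AdjoinRoot.mk_X]
  obtain ⟨e0, e1, e2, e3, e4⟩ := eq_zero_of_mk_relPoly_eq_zero h0
  obtain ⟨h0, h2, h3, h7⟩ := huv _ _ _ _ e0
  obtain ⟨h1, h5, h6, h11⟩ := huv _ _ _ _ e1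
  obtain ⟨h4, h9, h10, h15⟩ := huv _ _ _ _ e2
  obtain ⟨h8, h13, h14, h16⟩ := huv _ _ _ _ e3
  obtain ⟨h12, h17, h18, h19⟩ := huv _ _ _ _ e4
  have h16 : c 16 = 0 := by simpa using h16
  have h19 : c 19 = 0 := by simpa using h19
  rw [h16, mul_zero, add_zero] at h17 h18
  ext i
  fin_cases i <;> assumption

end Abstract

theorem rels : Rels m1 m2 m3 where
  y_sq := Ideal.Quotient.eq_zero_iff_mem.mpr (Ideal.subset_span (by simp))
  z_sq := Ideal.Quotient.eq_zero_iff_mem.mpr (Ideal.subset_span (by simp))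
  quintic := Ideal.Quotient.eq_zero_iff_mem.mpr (Ideal.subset_span (by simp))

theorem eq_zero_of_monComb_eq_zero {c : Fin 20 → ℂ} (hc : monComb m1 m2 m3 c = 0) : c = 0 := by
  have hy : (DualNumber.eps : DualNumber (DualNumber ℂ)) ^ 2 = 0 := by simp [pow_two]
  have hz : (TrivSqZeroExt.inl DualNumber.eps : DualNumber (DualNumber ℂ)) ^ 2 = 0 := by
    simp [pow_two, ← TrivSqZeroExt.inl_mul]
  refine rels.monComb_eq_zero ?_ (toAdjoin (A := DualNumber (DualNumber ℂ)) hy hz)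
    (toAdjoin_m1 _ _) (toAdjoin_m2 _ _) (toAdjoin_m3 _ _) hc
  intro p q r s h
  refine ⟨?_, ?_, ?_, ?_⟩
  · simpa using congrArg (fun a => a.fst.fst) h
  · simpa using congrArg (fun a => a.snd.fst) h
  · simpa using congrArg (fun a => a.fst.snd) h
  · simpa using congrArg (fun a => a.snd.snd) h

theorem exists_monComb_eq (b : R) : ∃ c, monComb m1 m2 m3 c = b := by
  obtain ⟨p, rfl⟩ := Ideal.Quotient.mk_surjective b
  obtain ⟨c, hc⟩ := rels.exists_monComb_eq p
  refine ⟨c, hc.trans ?_⟩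
  have h : MvPolynomial.aeval ![m1, m2, m3] = Ideal.Quotient.mkₐ ℂ IR := by
    apply MvPolynomial.algHom_ext
    intro i
    rw [MvPolynomial.aeval_X]
    fin_cases i <;> rfl
  exact congrArg (fun f : Poly3 →ₐ[ℂ] R => f p) h

/-- The coordinates of `(p + q m1 + r m1² + s m1³) β` in the monomial basis. -/
def betaCoords (p q r s : ℂ) : Fin 20 → ℂ :=
  ![0, 0, 0, 0, p, -2 * p, -p, p, q, -2 * q, -q, q, r, -2 * r, -r, r,
    2 / 3 * s, -4 / 3 * s, -1 / 3 * s, 0]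

/-- The coordinates of `(p + q m1 + r m1² + s m1³) β'` in the monomial basis. -/
def betaCoords' (p q r s : ℂ) : Fin 20 → ℂ :=
  ![0, 0, 0, 0, p, -p, -2 * p, p, q, -q, -2 * q, q, r, -r, -2 * r, r,
    2 / 3 * s, -1 / 3 * s, -4 / 3 * s, 0]

/-- The operator `N2` in the monomial basis. -/
def coordN2 (c : Fin 20 → ℂ) : Fin 20 → ℂ :=
  betaCoords (-c 2) (-(c 5 + c 7)) (-(c 9 + c 11)) (-(c 13 + c 15))

/-- The operator `N3` in the monomial basis. -/
def coordN3 (c : Fin 20 → ℂ) : Fin 20 → ℂ :=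
  betaCoords' (-c 3) (-(c 6 + c 7)) (-(c 10 + c 11)) (-(c 14 + c 15))

theorem coordN2_iterate (c : Fin 20 → ℂ) : coordN2^[5] c = 0 := by
  simp only [Function.iterate_succ, Function.iterate_zero, Function.comp_apply, id]
  ext i
  fin_cases i <;> simp [coordN2, betaCoords]

theorem coordN3_iterate (c : Fin 20 → ℂ) : coordN3^[5] c = 0 := by
  simp only [Function.iterate_succ, Function.iterate_zero, Function.comp_apply, id]
  ext i
  fin_cases i <;> simp [coordN3, betaCoords']

section Abstract

variable {B : Type*} [CommRing B] [Algebra ℂ B] {x y z : B}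

theorem Rels.monComb_betaCoords (h : Rels x y z) (p q r s : ℂ) :
    monComb x y z (betaCoords p q r s)
      = (p • 1 + q • x + r • x ^ 2 + s • x ^ 3) * ((x - y) * (x - y - z)) := by
  simp only [monComb, betaCoords, Matrix.cons_val]
  linear_combination (norm := algebra) - s • h.x_cube_mul
    - (p • 1 + q • x + r • x ^ 2 + s • x ^ 3) * h.y_sq

theorem Rels.monComb_betaCoords' (h : Rels x y z) (p q r s : ℂ) :
    monComb x y z (betaCoords' p q r s)
      = (p • 1 + q • x + r • x ^ 2 + s • x ^ 3) * ((x - z) * (x - y - z)) := by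
  simp only [monComb, betaCoords', Matrix.cons_val]
  linear_combination (norm := algebra) - s • h.x_cube_mul
    - (p • 1 + q • x + r • x ^ 2 + s • x ^ 3) * h.z_sq

theorem Rels.map_monComb_of_N2 (h : Rels x y z) {N : B →ₗ[ℂ] B} {b g : B}
    (hb : b = (x - y) * (x - y - z)) (hg : g = (x - y) * (x - z) * (x - y - z))
    (hN : ∀ i, N ((![1, x, y, z, x ^ 2, x * y, x * z, y * z, x ^ 3, x ^ 2 * y, x ^ 2 * z,
      x * y * z, x ^ 4, x ^ 3 * y, x ^ 3 * z, x ^ 2 * (y * z), x ^ 5, x ^ 4 * y, x ^ 4 * z,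
      x ^ 6] : Fin 20 → B) i) = (![0, 0, -b, 0, 0, -(x * b), 0, -(z * b) - g,
      0, -(x ^ 2 * b), 0, -(x * z * b) - x * g, 0, -(x ^ 3 * b), 0, -(x ^ 2 * (z * b)),
      0, 0, 0, 0] : Fin 20 → B) i) (c : Fin 20 → ℂ) :
    N (monComb x y z c) = monComb x y z (coordN2 c) := by
  simp only [Fin.forall_fin_succ, Matrix.cons_val_zero, Matrix.cons_val_succ] at hN
  rw [coordN2, h.monComb_betaCoords]
  simp only [monComb, map_add, map_smul, hN, smul_zero, hb, hg]
  linear_combination (norm := algebra) c 15 • h.quintic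

theorem Rels.map_monComb_of_N3 (h : Rels x y z) {N : B →ₗ[ℂ] B} {b g : B}
    (hb : b = (x - z) * (x - y - z)) (hg : g = (x - y) * (x - z) * (x - y - z))
    (hN : ∀ i, N ((![1, x, y, z, x ^ 2, x * y, x * z, y * z, x ^ 3, x ^ 2 * y, x ^ 2 * z,
      x * y * z, x ^ 4, x ^ 3 * y, x ^ 3 * z, x ^ 2 * (y * z), x ^ 5, x ^ 4 * y, x ^ 4 * z,
      x ^ 6] : Fin 20 → B) i) = (![0, 0, 0, -b, 0, 0, -(x * b), -(y * b) - g,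
      0, 0, -(x ^ 2 * b), -(x * y * b) - x * g, 0, 0, -(x ^ 3 * b), -(x ^ 2 * (y * b)),
      0, 0, 0, 0] : Fin 20 → B) i) (c : Fin 20 → ℂ) :
    N (monComb x y z c) = monComb x y z (coordN3 c) := by
  simp only [Fin.forall_fin_succ, Matrix.cons_val_zero, Matrix.cons_val_succ] at hN
  rw [coordN3, h.monComb_betaCoords']
  simp only [monComb, map_add, map_smul, hN, smul_zero, hb, hg]
  linear_combination (norm := algebra) c 15 • h.quintic

/-- The coordinates of a combination of the twelve generators of `V`. -/
def kerCoords (t : Fin 12 → ℂ) : Fin 20 → ℂ :=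
  ![t 0, t 1, 0, 0, t 2, t 7, t 7, -t 7, t 3, t 8, t 8, -t 8, t 4, t 9, t 9, -t 9, t 5, t 10,
    t 11, t 6]

/-- The twelve generators of `V` in terms of `x`, `y`, `z`. -/
def kerGen (x y z : B) : Fin 12 → B :=
  ![1, x, x ^ 2, x ^ 3, x ^ 4, x ^ 5, x ^ 6, x * y + x * z - y * z,
    x * (x * y + x * z - y * z), x ^ 2 * (x * y + x * z - y * z), x ^ 4 * y, x ^ 4 * z]

theorem sum_smul_kerGen (x y z : B) (t : Fin 12 → ℂ) :
    ∑ i, t i • kerGen x y z i = monComb x y z (kerCoords t) := by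
  simp only [kerGen, Fin.sum_univ_succ, Matrix.cons_val_zero, Matrix.cons_val_succ,
    Finset.univ_eq_empty, Finset.sum_empty, monComb, kerCoords, Matrix.cons_val]
  simp only [Fin.reduceSucc]
  algebra

theorem monComb_injective (hinj : ∀ c, monComb x y z c = 0 → c = 0) :
    Function.Injective (monComb x y z) := fun c d hcd => by
  have h : monComb x y z (c + (-1 : ℂ) • d) = 0 := by
    rw [monComb_add, monComb_smul, hcd]
    module
  have := hinj _ h
  rwa [neg_one_smul, ← sub_eq_add_neg, sub_eq_zero] at this

theorem mem_span_kerGen {v : B} :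
    v ∈ Submodule.span ℂ (Set.range (kerGen x y z)) ↔ ∃ t, monComb x y z (kerCoords t) = v := by
  simp only [Submodule.mem_span_range_iff_exists_fun, sum_smul_kerGen]

theorem isNilpotent_of_iterate_eq_zero (hsurj : ∀ b, ∃ c, monComb x y z c = b)
    {N : Module.End ℂ B} {L : (Fin 20 → ℂ) → Fin 20 → ℂ}
    (hN : ∀ c, N (monComb x y z c) = monComb x y z (L c)) {n : ℕ} (hL : ∀ c, L^[n] c = 0) :
    IsNilpotent N := by
  have hsc : Function.Semiconj (monComb x y z) L N := fun c => (hN c).symm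
  refine ⟨n, LinearMap.ext fun b => ?_⟩
  obtain ⟨c, rfl⟩ := hsurj b
  rw [Module.End.pow_apply, ← (hsc.iterate_right n) c, hL]
  simp [monComb]

theorem ker_inf_ker_eq (hinj : ∀ c, monComb x y z c = 0 → c = 0)
    (hsurj : ∀ b, ∃ c, monComb x y z c = b) {N₂ N₃ : B →ₗ[ℂ] B}
    (h2 : ∀ c, N₂ (monComb x y z c) = monComb x y z (coordN2 c))
    (h3 : ∀ c, N₃ (monComb x y z c) = monComb x y z (coordN3 c)) :
    LinearMap.ker N₂ ⊓ LinearMap.ker N₃ = Submodule.span ℂ (Set.range (kerGen x y z)) := by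
  ext v
  obtain ⟨c, rfl⟩ := hsurj v
  rw [mem_span_kerGen, Submodule.mem_inf, LinearMap.mem_ker, LinearMap.mem_ker, h2, h3]
  constructor
  · rintro ⟨e2, e3⟩
    have e2 := hinj _ e2
    have e3 := hinj _ e3
    have k2 : c 2 = 0 := by simpa [coordN2, betaCoords] using congrFun e2 7
    have k5 : c 5 + c 7 = 0 := neg_eq_zero.mp (congrFun e2 11)
    have k9 : c 9 + c 11 = 0 := neg_eq_zero.mp (congrFun e2 15)
    have k13 : c 13 + c 15 = 0 := by
      have : 2 / 3 * -(c 13 + c 15) = 0 := congrFun e2 16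
      linear_combination -3 / 2 * this
    have k3 : c 3 = 0 := neg_eq_zero.mp (congrFun e3 7)
    have k6 : c 6 + c 7 = 0 := neg_eq_zero.mp (congrFun e3 11)
    have k10 : c 10 + c 11 = 0 := neg_eq_zero.mp (congrFun e3 15)
    have k14 : c 14 + c 15 = 0 := by
      have : 2 / 3 * -(c 14 + c 15) = 0 := congrFun e3 16
      linear_combination -3 / 2 * this
    refine ⟨![c 0, c 1, c 4, c 8, c 12, c 16, c 19, c 5, c 9, c 13, c 17, c 18],
      congrArg _ (funext fun i => ?_)⟩
    fin_cases i <;> simp [kerCoords] <;> grind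
  · rintro ⟨t, ht⟩
    rw [← monComb_injective hinj ht]
    constructor <;> simp [coordN2, coordN3, betaCoords, betaCoords', kerCoords, monComb]

theorem finrank_span_kerGen (hinj : ∀ c, monComb x y z c = 0 → c = 0) :
    Module.finrank ℂ (Submodule.span ℂ (Set.range (kerGen x y z))) = 12 := by
  have hli : LinearIndependent ℂ (kerGen x y z) := by
    rw [Fintype.linearIndependent_iff]
    intro t ht
    rw [sum_smul_kerGen] at ht
    have h0 := hinj _ ht
    have h (i) : kerCoords t i = 0 := congrFun h0 i
    intro i
    fin_cases i
    exacts [h 0, h 1, h 4, h 8, h 12, h 16, h 19, h 5, h 9, h 13, h 17, h 18]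
  simpa using finrank_span_eq_card hli

theorem smul_add_smul_eq_monComb (a b : ℂ) :
    a • (x ^ 4 * y - x ^ 4 * z) + b • (2 * x ^ 5 - 5 * (x ^ 4 * y)) = monComb x y z
      ![0, 0, 0, 0, 0, 0, 0, 0, 0, 0, 0, 0, 0, 0, 0, 0, 2 * b, a - 5 * b, -a, 0] := by
  simp only [monComb, Matrix.cons_val]
  algebra

theorem finrank_span_pair_eq_two (hinj : ∀ c, monComb x y z c = 0 → c = 0) :
    Module.finrank ℂ (Submodule.span ℂ
      {x ^ 4 * y - x ^ 4 * z, 2 * x ^ 5 - 5 * (x ^ 4 * y)}) = 2 := by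
  have hli : LinearIndependent ℂ ![x ^ 4 * y - x ^ 4 * z, 2 * x ^ 5 - 5 * (x ^ 4 * y)] := by
    rw [LinearIndependent.pair_iff]
    intro a b hab
    rw [smul_add_smul_eq_monComb] at hab
    have h := hinj _ hab
    have ha : -a = 0 := congrFun h 18
    have hb : 2 * b = 0 := congrFun h 16
    exact ⟨neg_eq_zero.mp ha, by simpa using hb⟩
  rw [← Matrix.range_cons_cons_empty _ _ ![], finrank_span_eq_card hli, Fintype.card_fin]

theorem span_kerGen_inf_range (hinj : ∀ c, monComb x y z c = 0 → c = 0)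
    (hsurj : ∀ b, ∃ c, monComb x y z c = b) {N₂ N₃ : B →ₗ[ℂ] B}
    (h2 : ∀ c, N₂ (monComb x y z c) = monComb x y z (coordN2 c))
    (h3 : ∀ c, N₃ (monComb x y z c) = monComb x y z (coordN3 c)) :
    Submodule.span ℂ (Set.range (kerGen x y z)) ⊓ (LinearMap.range N₂ ⊔ LinearMap.range N₃)
      = Submodule.span ℂ {x ^ 4 * y - x ^ 4 * z, 2 * x ^ 5 - 5 * (x ^ 4 * y)} := by
  ext v
  rw [Submodule.mem_inf, mem_span_kerGen, Submodule.mem_sup, Submodule.mem_span_pair]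
  simp only [smul_add_smul_eq_monComb]
  constructor
  · rintro ⟨⟨t, rfl⟩, _, ⟨u, rfl⟩, _, ⟨w, rfl⟩, huw⟩
    obtain ⟨c, rfl⟩ := hsurj u
    obtain ⟨d, rfl⟩ := hsurj w
    rw [h2, h3, ← monComb_add] at huw
    have e := monComb_injective hinj huw
    rw [← huw]
    obtain ⟨p0, p1, p2, p3, hp⟩ : ∃ p0 p1 p2 p3, coordN2 c = betaCoords p0 p1 p2 p3 :=
      ⟨_, _, _, _, rfl⟩
    obtain ⟨q0, q1, q2, q3, hq⟩ : ∃ q0 q1 q2 q3, coordN3 d = betaCoords' q0 q1 q2 q3 :=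
      ⟨_, _, _, _, rfl⟩
    rw [hp, hq] at e ⊢
    have k5 : -2 * p0 + -q0 = t 7 := congrFun e 5
    have k6 : -p0 + -2 * q0 = t 7 := congrFun e 6
    have k7 : p0 + q0 = -t 7 := congrFun e 7
    have k9 : -2 * p1 + -q1 = t 8 := congrFun e 9
    have k10 : -p1 + -2 * q1 = t 8 := congrFun e 10
    have k11 : p1 + q1 = -t 8 := congrFun e 11
    have k13 : -2 * p2 + -q2 = t 9 := congrFun e 13
    have k14 : -p2 + -2 * q2 = t 9 := congrFun e 14
    have k15 : p2 + q2 = -t 9 := congrFun e 15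
    obtain rfl : p0 = 0 := by linear_combination -k5 - k7
    obtain rfl : q0 = 0 := by linear_combination -k6 - k7
    obtain rfl : p1 = 0 := by linear_combination -k9 - k11
    obtain rfl : q1 = 0 := by linear_combination -k10 - k11
    obtain rfl : p2 = 0 := by linear_combination -k13 - k15
    obtain rfl : q2 = 0 := by linear_combination -k14 - k15
    refine ⟨(p3 + 4 * q3) / 3, (p3 + q3) / 3, congrArg _ (funext fun i => ?_)⟩
    fin_cases i <;> simp [betaCoords, betaCoords'] <;> ring
  · rintro ⟨a, b, rfl⟩
    refine ⟨⟨![0, 0, 0, 0, 0, 2 * b, 0, 0, 0, 0, a - 5 * b, -a], congrArg _ (funext fun i => ?_)⟩,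
      N₂ (monComb x y z (Pi.single 13 (a - 4 * b))), ⟨_, rfl⟩,
      N₃ (monComb x y z (Pi.single 14 (b - a))), ⟨_, rfl⟩, ?_⟩
    · fin_cases i <;> simp [kerCoords]
    · rw [h2, h3, ← monComb_add]
      refine congrArg _ (funext fun i => ?_)
      fin_cases i <;> simp [coordN2, coordN3, betaCoords, betaCoords'] <;> ring

end Abstract

theorem stmt12
    (N2 N3 : R →ₗ[ℂ] R)
    (hN2 : ∀ i, N2 (mon i) = N2img i)
    (hN3 : ∀ i, N3 (mon i) = N3img i) :
    IsNilpotent (N2 : Module.End ℂ R) ∧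
    IsNilpotent (N3 : Module.End ℂ R) ∧
    LinearMap.ker N2 ⊓ LinearMap.ker N3 = V ∧
    Module.finrank ℂ V = 12 ∧
    V ⊓ (LinearMap.range N2 ⊔ LinearMap.range N3) = W ∧
    Module.finrank ℂ W = 2 := by
  have hinj (c) (hc : monComb m1 m2 m3 c = 0) : c = 0 := eq_zero_of_monComb_eq_zero hc
  have h2 := rels.map_monComb_of_N2 rfl rfl hN2
  have h3 := rels.map_monComb_of_N3 rfl rfl hN3
  exact ⟨isNilpotent_of_iterate_eq_zero exists_monComb_eq h2 coordN2_iterate,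
    isNilpotent_of_iterate_eq_zero exists_monComb_eq h3 coordN3_iterate,
    ker_inf_ker_eq hinj exists_monComb_eq h2 h3, finrank_span_kerGen hinj,
    span_kerGen_inf_range hinj exists_monComb_eq h2 h3, finrank_span_pair_eq_two hinj⟩
end
end
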